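/- Let V₀ > 0 and W∥, W⊥ ∈ ℝ, and set V_b = √(W⊥² + max(0, −W∥)²). Then the speed-to-fly equation V⁶ − (3/2)·V⁴·W⊥² + (1/2)·W∥·√(V² − W⊥²)·(3V⁴ − V₀⁴) − V²·V₀⁴ + (1/2)·W⊥²·V₀⁴ = 0 has exactly one solution V in the open interval (V_b, ∞). -/

import Mathlib

/-- Strict monotonicity of the auxiliary ratio. -/
lemma stf_mono (a w m : ℝ) (hm0 : 0 ≤ m) (hma : -a ≤ m) :
    StrictMonoOn (fun u : ℝ => ((u^2+w^2)^2 * (u^2+3/2*a*u-w^2/2)) / (u^2+a*u/2+w^2/2))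
      (Set.Ioi m) := by
  have hD : ∀ u ∈ Set.Ioi m, 0 < u^2+a*u/2+w^2/2 := by
    intro u hu
    have hu' : m < u := hu
    have h0 : 0 < u := by linarith
    have h1 : 0 < u + a := by linarith
    have := mul_pos h0 h1
    nlinarith [sq_nonneg w, mul_pos h0 h0]
  have hder : ∀ u ∈ Set.Ioi m, HasDerivAt
      (fun u : ℝ => ((u^2+w^2)^2 * (u^2+3/2*a*u-w^2/2)) / (u^2+a*u/2+w^2/2))
      ((u^2+w^2) * ((u+a)*(u^3*(4*u+3*a)+2*u^2*w^2+w^4)) / (u^2+a*u/2+w^2/2)^2) u := by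
    intro u hu
    have h2 : HasDerivAt (fun u : ℝ => u^2) (2*u) u := by
      simpa using hasDerivAt_pow 2 u
    have hx := (h2.add_const (w^2)).pow 2
    have hN := (h2.add ((hasDerivAt_id u).const_mul (3/2*a))).sub_const (w^2/2)
    have hDD := (h2.add (((hasDerivAt_id u).const_mul a).div_const 2)).add_const (w^2/2)
    have := (hx.mul hN).div hDD (hD u hu).ne'
    refine (this.congr_deriv ?_)
    simp
    congr 1
    ring
  apply strictMonoOn_of_deriv_pos (convex_Ioi m)
  · intro u hu
    exact (hder u hu).continuousAt.continuousWithinAt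
  · intro u hu
    rw [interior_Ioi] at hu
    rw [(hder u hu).deriv]
    have hu' : m < u := hu
    have h0 : 0 < u := by linarith
    have h1 : 0 < u + a := by linarith
    have h3 : 0 < 4*u+3*a := by linarith
    have := hD u hu
    positivity

lemma stf_exists (V₀ a w : ℝ) (hV : 0 < V₀) :
    ∃ u, max 0 (-a) < u ∧
      (u^2+w^2)^2 * (u^2+3/2*a*u-w^2/2) - V₀^4 * (u^2+a*u/2+w^2/2) = 0 := by
  set m := max 0 (-a) with hm
  set f : ℝ → ℝ := fun u =>
    (u^2+w^2)^2 * (u^2+3/2*a*u-w^2/2) - V₀^4 * (u^2+a*u/2+w^2/2) with hf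
  have hcont : Continuous f := by rw [hf]; fun_prop
  set M := 4*(|a|+|w|+V₀) with hM
  have ha := abs_nonneg a
  have hw := abs_nonneg w
  have hMm : m < M := by
    rw [hm, max_lt_iff]
    constructor
    · positivity
    · linarith [neg_le_abs a]
  have hMV : V₀ < M := by linarith
  have hMpos : 0 < M := by linarith
  have hfM : 0 < f M := by
    have e1 : |a*M| ≤ M^2/4 := by
      rw [abs_mul, abs_of_pos hMpos]; nlinarith
    have e2 : w^2 ≤ M^2/16 := by
      rw [← sq_abs w]; nlinarith
    obtain ⟨e3, e4⟩ := abs_le.mp e1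
    have hN : M^2/2 ≤ M^2+3/2*a*M-w^2/2 := by nlinarith
    have hD : M^2+a*M/2+w^2/2 ≤ 3/2*M^2 := by nlinarith
    have hx : 256*V₀^4 ≤ (M^2+w^2)^2 := by
      have : (4*V₀)^2 ≤ M^2+w^2 := by nlinarith [sq_nonneg w]
      have := pow_le_pow_left₀ (by positivity) this 2
      linarith
    have g1 : 256*V₀^4 * (M^2/2) ≤ (M^2+w^2)^2 * (M^2+3/2*a*M-w^2/2) :=
      mul_le_mul hx hN (by positivity) (by positivity)
    have g2 := mul_le_mul_of_nonneg_left hD (show 0 ≤ V₀^4 by positivity)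
    have g3 : 0 < V₀^4*M^2 := by positivity
    simp only [hf]
    linarith
  have key : ∀ c, m ≤ c → c ≤ M → f c < 0 → ∃ u, m < u ∧ f u = 0 := by
    intro c hc hcM hfc
    obtain ⟨u, hu, hu0⟩ := intermediate_value_Icc hcM hcont.continuousOn
      (show (0:ℝ) ∈ Set.Icc (f c) (f M) from ⟨hfc.le, hfM.le⟩)
    refine ⟨u, lt_of_le_of_ne (hc.trans hu.1) ?_, hu0⟩
    intro h
    have : u = c := le_antisymm (h ▸ hc) hu.1
    rw [this] at hu0
    linarith
  by_cases h0 : 0 ≤ a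
  · have hm0 : m = 0 := by rw [hm]; exact max_eq_left (by linarith)
    by_cases hw0 : w = 0
    · apply key (V₀/2) (by rw [hm0]; positivity) (by linarith)
      have : f (V₀/2) = - (V₀^6 * (15/64) + V₀^5*a*(13/64)) := by
        simp only [hf, hw0]; ring
      rw [this]
      have : 0 < V₀^6 := by positivity
      have : 0 ≤ V₀^5*a := by positivity
      linarith
    · apply key 0 hm0.le hMpos.le
      have : f 0 = - (w^6/2 + V₀^4*w^2/2) := by simp only [hf]; ring
      rw [this]
      have : 0 < w^2 := by positivity
      have : 0 < V₀^4*w^2 := by positivity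
      have : 0 ≤ w^6 := by positivity
      linarith
  · push Not at h0
    have hm0 : m = -a := by rw [hm]; exact max_eq_right (by linarith)
    apply key (-a) hm0.le (hm0 ▸ hMm.le)
    have : f (-a) = - (((a^2+w^2)^2 + V₀^4) * (a^2+w^2)/2) := by simp only [hf]; ring
    rw [this]
    have : 0 < a^2 := by nlinarith
    have : 0 < ((a^2+w^2)^2 + V₀^4) * (a^2+w^2)/2 := by positivity
    linarith


/-- The speed-to-fly equation has exactly one solution `V` in `(V_b, ∞)`, where
`V_b = √(W⊥² + max(0, −W∥)²)` is the minimal airspeed for which the ground speed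
is positive and well defined. -/
theorem speed_to_fly_unique_solution
    (V₀ Wpar Wperp : ℝ) (hV₀ : 0 < V₀) :
    ∃! V : ℝ, Real.sqrt (Wperp ^ 2 + (max 0 (-Wpar)) ^ 2) < V ∧
      V ^ 6 - (3 / 2) * V ^ 4 * Wperp ^ 2
        + (1 / 2) * Wpar * Real.sqrt (V ^ 2 - Wperp ^ 2) * (3 * V ^ 4 - V₀ ^ 4)
        - V ^ 2 * V₀ ^ 4 + (1 / 2) * Wperp ^ 2 * V₀ ^ 4 = 0 := by
  set m := max 0 (-Wpar) with hm
  have hm0 : 0 ≤ m := le_max_left _ _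
  have hma : -Wpar ≤ m := le_max_right _ _
  have hD : ∀ u, m < u → 0 < u^2+Wpar*u/2+Wperp^2/2 := by
    intro u hu'
    have h0 : 0 < u := by linarith
    have h1 : 0 < u + Wpar := by linarith
    have := mul_pos h0 h1
    nlinarith [sq_nonneg Wperp, mul_pos h0 h0]
  obtain ⟨u, hu, hu0⟩ := stf_exists V₀ Wpar Wperp hV₀
  rw [← hm] at hu
  have hupos : 0 < u := by linarith
  have hs : Real.sqrt (u^2+Wperp^2) ^ 2 = u^2+Wperp^2 := Real.sq_sqrt (by positivity)
  refine ⟨Real.sqrt (u^2+Wperp^2), ⟨?_, ?_⟩, ?_⟩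
  · apply Real.sqrt_lt_sqrt (by positivity)
    nlinarith
  · set s := Real.sqrt (u^2+Wperp^2) with hsdef
    have h1 : Real.sqrt (s^2 - Wperp^2) = u := by
      rw [hs, add_sub_cancel_right, Real.sqrt_sq hupos.le]
    rw [h1, show s^6 = (s^2)^3 by ring, show s^4 = (s^2)^2 by ring, hs]
    linear_combination hu0
  · rintro V ⟨hV, hE⟩
    have hV0 : 0 < V := lt_of_le_of_lt (Real.sqrt_nonneg _) hV
    have hV2 := (Real.sqrt_lt' hV0).mp hV
    set v := Real.sqrt (V^2 - Wperp^2) with hv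
    have hvs : v^2 = V^2 - Wperp^2 := Real.sq_sqrt (by nlinarith [sq_nonneg m])
    have hmv : m < v := by
      apply Real.lt_sqrt_of_sq_lt
      linarith
    have hVx : V^2 = v^2 + Wperp^2 := by linarith
    rw [show V^6 = (V^2)^3 by ring, show V^4 = (V^2)^2 by ring, hVx] at hE
    have hv0 : (v^2+Wperp^2)^2 * (v^2+3/2*Wpar*v-Wperp^2/2)
        - V₀^4 * (v^2+Wpar*v/2+Wperp^2/2) = 0 := by
      linear_combination hE
    have huv : v = u := by
      apply (stf_mono Wpar Wperp m hm0 hma).injOn hmv hu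
      simp only
      rw [sub_eq_zero.mp hv0, sub_eq_zero.mp hu0, mul_div_cancel_right₀ _ (hD v hmv).ne',
        mul_div_cancel_right₀ _ (hD u hu).ne']
    rw [← huv, ← hVx, Real.sqrt_sq hV0.le]
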